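/- Let G be an almost Moore digraph of degree d > 1 and diameter k > 1 with self-repeats and permutation cycle structure (k, …, m_{d−1}, 0, …, 0), with adjacency matrix A. Let λ₁, …, λ_{m(1)−1} be the eigenvalues of A (with multiplicity) that are roots of x^k + ⋯ + x² + x, where m(1) is the total number of cycles of r. Then for every integer ℓ with 1 ≤ ℓ < (k+1)/(d−1), one has 0 = d^ℓ + Σ_{h=1}^{m(1)−1} λ_h^ℓ. -/

import Mathlib

/-- `IsWalkFrom A u v l` : the list `u :: l` is a directed walk from `u` to `v`
along the adjacency relation `A`; the length of the walk is `l.length`. -/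
def IsWalkFrom {V : Type} (A : V → V → Prop) (u v : V) (l : List V) : Prop :=
  List.Chain A u l ∧ (u :: l).getLast (List.cons_ne_nil u l) = v

/-- An almost Moore digraph (a `(d,k)`-digraph): a diregular digraph of degree `d > 1`,
diameter `k > 1` and order `d + d² + ⋯ + d^k`, together with its repeat permutation `rep`:
for every vertex `v`, every vertex `w ≠ rep v` is reached from `v` by exactly one walk of
length at most `k`, while `rep v` is reached by exactly two such walks, at least one of
which has length `k`.  The map `rep` is an automorphism of the digraph. -/
structure AlmostMooreDigraph (d k : ℕ) where
  hd : 1 < d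
  hk : 1 < k
  V : Type
  [fintypeV : Fintype V]
  [decEqV : DecidableEq V]
  Adj : V → V → Prop
  [adjDec : DecidableRel Adj]
  loopless : ∀ v, ¬ Adj v v
  out_deg : ∀ v, {w | Adj v w}.ncard = d
  in_deg : ∀ v, {w | Adj w v}.ncard = d
  reach : ∀ u v, ∃ l, IsWalkFrom Adj u v l ∧ l.length ≤ k
  diam : ∃ u v, ∀ l, IsWalkFrom Adj u v l → k ≤ l.length
  card_eq : Fintype.card V = ∑ i ∈ Finset.range k, d ^ (i + 1)
  rep : V → V
  rep_spec : ∀ v w, w ≠ rep v → ∃! l, IsWalkFrom Adj v w l ∧ l.length ≤ k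
  rep_two : ∀ v, ∃ l₁ l₂, l₁ ≠ l₂ ∧
      IsWalkFrom Adj v (rep v) l₁ ∧ l₁.length ≤ k ∧
      IsWalkFrom Adj v (rep v) l₂ ∧ l₂.length ≤ k ∧
      (l₁.length = k ∨ l₂.length = k) ∧
      (∀ l, IsWalkFrom Adj v (rep v) l → l.length ≤ k → l = l₁ ∨ l = l₂)
  rep_bijective : Function.Bijective rep
  rep_adj : ∀ u v, Adj u v ↔ Adj (rep u) (rep v)

attribute [instance] AlmostMooreDigraph.fintypeV AlmostMooreDigraph.decEqV
  AlmostMooreDigraph.adjDec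

/-- `ordRep M v` : the smallest `t ≥ 1` with `rep^t v = v`. -/
noncomputable def ordRep {d k : ℕ} (M : AlmostMooreDigraph d k) (v : M.V) : ℕ :=
  sInf {t | 0 < t ∧ M.rep^[t] v = v}

/-- The vertex set of the subdigraph `H_α`: vertices whose order under the repeat
permutation divides `2^t * α` for some `t ≥ 0`. -/
def Hset {d k : ℕ} (M : AlmostMooreDigraph d k) (α : ℕ) : Set M.V :=
  {v | ∃ t : ℕ, ordRep M v ∣ 2 ^ t * α}

open scoped Classical

/-- The adjacency matrix of an almost Moore digraph, with complex entries. -/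
noncomputable def adjMatC {d k : ℕ} (M : AlmostMooreDigraph d k) : Matrix M.V M.V ℂ :=
  Matrix.of fun u w => if M.Adj u w then 1 else 0

namespace Matrix

variable {n K : Type*} [Fintype n] [DecidableEq n] [Field K] [IsAlgClosed K]

open Polynomial in
/-- The determinant of `p(A)` is the product of the values of `p` at the eigenvalues of `A`. -/
theorem det_aeval_eq_prod_roots_charpoly (A : Matrix n n K) (p : K[X]) :
    (aeval A p).det = (A.charpoly.roots.map p.eval).prod := by
  have hcard : A.charpoly.roots.card = Fintype.card n := by
    rw [← (IsAlgClosed.splits A.charpoly).natDegree_eq_card_roots, charpoly_natDegree_eq_dim]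
  have hχ (x : K) : (scalar n x - A).det = (A.charpoly.roots.map fun z => x - z).prod := by
    rw [← eval_charpoly]
    conv_lhs => rw [(IsAlgClosed.splits A.charpoly).eq_prod_roots_of_monic A.charpoly_monic]
    simp [eval_multiset_prod, Multiset.map_map]
  have hp : p.Splits := IsAlgClosed.splits p
  induction hp using Submonoid.closure_induction with
  | mem q hq =>
    rcases hq with ⟨a, rfl⟩ | ⟨a, rfl⟩
    · simp [hcard, algebraMap_eq_diagonal, det_diagonal]
    · have h := hχ (-a)
      have e1 : scalar n (-a) - A = -(aeval A (X + C a)) := by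
        simp [algebraMap_eq_diagonal, scalar_apply, ← diagonal_neg, sub_eq_add_neg, add_comm]
      have e2 : (A.charpoly.roots.map fun z => -a - z) =
          (A.charpoly.roots.map (X + C a).eval).map Neg.neg := by
        simp only [Multiset.map_map]
        exact Multiset.map_congr rfl fun z _ => by simp; ring
      rw [e1, e2, det_neg, Multiset.prod_map_neg, Multiset.card_map, hcard] at h
      exact mul_left_cancel₀ (pow_ne_zero _ (neg_ne_zero.2 one_ne_zero)) h
  | one => simp
  | mul q r _ _ hq hr => simp [hq, hr, Multiset.prod_map_mul]

open Polynomial in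
/-- The eigenvalues of `p(A)` are the values of `p` at the eigenvalues of `A`. -/
theorem roots_charpoly_aeval (A : Matrix n n K) (p : K[X]) :
    (aeval A p).charpoly.roots = A.charpoly.roots.map p.eval := by
  have h : (aeval A p).charpoly =
      ((A.charpoly.roots.map p.eval).map fun z => X - C z).prod := by
    refine Polynomial.funext fun t => ?_
    have e : scalar n t - aeval A p = aeval A (C t - p) := by
      simp [algebraMap_eq_diagonal, scalar_apply]
    rw [eval_charpoly, e, det_aeval_eq_prod_roots_charpoly]
    simp [eval_multiset_prod, Multiset.map_map]
  rw [h, roots_multiset_prod_X_sub_C]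

open Polynomial in
theorem trace_aeval_eq_sum_roots_charpoly (A : Matrix n n K) (p : K[X]) :
    (aeval A p).trace = (A.charpoly.roots.map p.eval).sum := by
  rw [trace_eq_sum_roots_charpoly, roots_charpoly_aeval]

end Matrix

theorem isWalkFrom_nil {V : Type} {A : V → V → Prop} {u v : V} :
    IsWalkFrom A u v [] ↔ u = v := by
  simp [IsWalkFrom, List.Chain]

theorem isWalkFrom_cons {V : Type} {A : V → V → Prop} {u v w : V} {l : List V} :
    IsWalkFrom A u v (w :: l) ↔ A u w ∧ IsWalkFrom A w v l := by
  simp [IsWalkFrom, List.Chain, and_assoc]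

theorem IsWalkFrom.append {V : Type} {A : V → V → Prop} {u v w : V} {l₁ l₂ : List V}
    (h₁ : IsWalkFrom A u v l₁) (h₂ : IsWalkFrom A v w l₂) : IsWalkFrom A u w (l₁ ++ l₂) := by
  induction l₁ generalizing u with
  | nil => rwa [isWalkFrom_nil.1 h₁]
  | cons x l ih =>
    rw [isWalkFrom_cons] at h₁
    exact isWalkFrom_cons.2 ⟨h₁.1, ih h₁.2⟩

theorem IsWalkFrom.map {V : Type} {A : V → V → Prop} {f : V → V}
    (hf : ∀ u v, A u v → A (f u) (f v)) {u v : V} {l : List V}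
    (h : IsWalkFrom A u v l) : IsWalkFrom A (f u) (f v) (l.map f) := by
  induction l generalizing u with
  | nil => exact isWalkFrom_nil.2 (congrArg f (isWalkFrom_nil.1 h))
  | cons x l ih =>
    rw [isWalkFrom_cons] at h
    exact isWalkFrom_cons.2 ⟨hf _ _ h.1, ih h.2⟩

/-- The finite set of walks of length `n` from `u` to `v`. -/
def walkFinset {V : Type} [Fintype V] [DecidableEq V] (A : V → V → Prop) [DecidableRel A] :
    ℕ → V → V → Finset (List V)
  | 0, u, v => if u = v then {[]} else ∅
  | n + 1, u, v => (Finset.univ.filter (A u)).biUnion fun w =>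
      (walkFinset A n w v).image (List.cons w)

theorem mem_walkFinset {V : Type} [Fintype V] [DecidableEq V] {A : V → V → Prop} [DecidableRel A] {n : ℕ} {u v : V}
    {l : List V} : l ∈ walkFinset A n u v ↔ IsWalkFrom A u v l ∧ l.length = n := by
  induction n generalizing u l with
  | zero =>
    rw [walkFinset]
    cases l with
    | nil => split_ifs with h <;> simp [isWalkFrom_nil, h]
    | cons x l => split_ifs <;> simp
  | succ n ih =>
    cases l with
    | nil => simp [walkFinset]
    | cons x l => simp [walkFinset, ih, isWalkFrom_cons, and_assoc]

section AlmostMoore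

variable {d k : ℕ} (M : AlmostMooreDigraph d k)

theorem adjMatC_pow_apply (n : ℕ) (u v : M.V) :
    (adjMatC M ^ n) u v = ((walkFinset M.Adj n u v).card : ℂ) := by
  induction n generalizing u with
  | zero => by_cases h : u = v <;> simp [walkFinset, h]
  | succ n ih =>
    rw [walkFinset, Finset.card_biUnion, pow_succ', Matrix.mul_apply]
    · have hadj (w : M.V) : adjMatC M u w = if M.Adj u w then 1 else 0 := rfl
      simp [hadj, ih, Finset.card_image_of_injective, List.cons_injective,
        Finset.sum_filter]
    · intro x _ y _ hxy
      refine Finset.disjoint_left.2 fun l hl hl' => hxy ?_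
      obtain ⟨a, _, rfl⟩ := Finset.mem_image.1 hl
      obtain ⟨b, _, h⟩ := Finset.mem_image.1 hl'
      exact (List.cons.inj h).1.symm

/-- The matrix of the repeat permutation. -/
noncomputable def repMat : Matrix M.V M.V ℂ :=
  Matrix.of fun u v => if v = M.rep u then 1 else 0

/-- The all-ones matrix. -/
def onesMat : Matrix M.V M.V ℂ :=
  Matrix.of fun _ _ => 1

theorem sum_adjMatC_pow :
    ∑ n ∈ Finset.range (k + 1), adjMatC M ^ n = onesMat M + repMat M := by
  ext u v
  set W := (Finset.range (k + 1)).biUnion fun n => walkFinset M.Adj n u v with hW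
  have hmem (l : List M.V) : l ∈ W ↔ IsWalkFrom M.Adj u v l ∧ l.length ≤ k := by
    simp [hW, mem_walkFinset, and_comm]
  have hcard : W.card = ∑ n ∈ Finset.range (k + 1), (walkFinset M.Adj n u v).card :=
    Finset.card_biUnion fun m _ n _ hmn => Finset.disjoint_left.2 fun l hl hl' =>
      hmn ((mem_walkFinset.1 hl).2.symm.trans (mem_walkFinset.1 hl').2)
  have hsum : (∑ n ∈ Finset.range (k + 1), adjMatC M ^ n) u v = (W.card : ℂ) := by
    simp [Matrix.sum_apply, adjMatC_pow_apply, hcard]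
  rw [hsum, Matrix.add_apply]
  by_cases hv : v = M.rep u
  · subst hv
    obtain ⟨l₁, l₂, hne, h₁, h₁', h₂, h₂', -, huniq⟩ := M.rep_two u
    have : W = {l₁, l₂} := by
      ext l
      simp only [hmem, Finset.mem_insert, Finset.mem_singleton]
      refine ⟨fun h => huniq l h.1 h.2, ?_⟩
      rintro (rfl | rfl)
      exacts [⟨h₁, h₁'⟩, ⟨h₂, h₂'⟩]
    simp [this, Finset.card_pair hne, onesMat, repMat]
    norm_num
  · obtain ⟨l₀, h₀, huniq⟩ := M.rep_spec u v hv
    have : W = {l₀} := by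
      ext l
      simp only [hmem, Finset.mem_singleton]
      exact ⟨huniq l, by rintro rfl; exact h₀⟩
    simp [this, onesMat, repMat, hv]

theorem onesMat_mul_onesMat :
    onesMat M * onesMat M = (Fintype.card M.V : ℂ) • onesMat M := by
  ext u v
  simp [onesMat, Matrix.mul_apply]

theorem repMat_mul_onesMat : repMat M * onesMat M = onesMat M := by
  ext u v
  simp [onesMat, repMat, Matrix.mul_apply]

theorem onesMat_mul_repMat : onesMat M * repMat M = onesMat M := by
  ext u v
  obtain ⟨w, rfl⟩ := M.rep_bijective.2 v
  simp [onesMat, repMat, Matrix.mul_apply, M.rep_bijective.1.eq_iff]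

theorem repMat_pow_apply (s : ℕ) (u v : M.V) :
    (repMat M ^ s) u v = if v = M.rep^[s] u then 1 else 0 := by
  induction s generalizing u with
  | zero => rcases eq_or_ne u v with rfl | h <;> simp [*, Ne.symm]
  | succ s ih =>
    have hrep (w : M.V) : repMat M u w = if w = M.rep u then 1 else 0 := rfl
    rw [pow_succ', Matrix.mul_apply, Function.iterate_succ_apply]
    simp only [ih, hrep, ite_mul, one_mul, zero_mul, Finset.sum_ite_eq', Finset.mem_univ, if_true]

theorem adjMatC_mul_onesMat : adjMatC M * onesMat M = (d : ℂ) • onesMat M := by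
  ext u v
  have h := M.out_deg u
  rw [Set.ncard_eq_toFinset_card'] at h
  simp [onesMat, adjMatC, Matrix.mul_apply, ← h]

theorem adjMatC_pow_mul_onesMat (ℓ : ℕ) :
    adjMatC M ^ ℓ * onesMat M = (d : ℂ) ^ ℓ • onesMat M := by
  induction ℓ with
  | zero => simp
  | succ ℓ ih =>
    rw [pow_succ, mul_assoc, adjMatC_mul_onesMat, mul_smul_comm, ih, smul_smul, pow_succ']

theorem exists_rep_iterate_eq_id : ∃ L, 0 < L ∧ ∀ v, M.rep^[L] v = v := by
  let σ := Equiv.ofBijective M.rep M.rep_bijective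
  refine ⟨orderOf σ, orderOf_pos σ, fun v => ?_⟩
  have h : (σ ^ orderOf σ) v = v := by rw [pow_orderOf_eq_one]; rfl
  rwa [Equiv.Perm.coe_pow] at h

theorem ordRep_mem (v : M.V) : 0 < ordRep M v ∧ M.rep^[ordRep M v] v = v := by
  obtain ⟨L, hL, h⟩ := exists_rep_iterate_eq_id M
  exact Nat.sInf_mem (s := {t | 0 < t ∧ M.rep^[t] v = v}) ⟨L, hL, h v⟩

/-- A nonempty closed walk of length at most `k` is based at a self-repeat and has length `k`. -/
theorem IsWalkFrom.closed {v : M.V} {l : List M.V} (h : IsWalkFrom M.Adj v v l) (hl : l ≠ [])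
    (hk : l.length ≤ k) : M.rep v = v ∧ l.length = k := by
  have hnil : IsWalkFrom M.Adj v v [] := isWalkFrom_nil.2 rfl
  by_cases hv : M.rep v = v
  · refine ⟨hv, ?_⟩
    obtain ⟨l₁, l₂, -, -, -, -, -, hor, huniq⟩ := M.rep_two v
    rw [hv] at huniq
    have hk1 := M.hk
    rcases huniq l h hk with rfl | rfl <;> rcases huniq [] hnil (by simp) with rfl | rfl <;>
      simp_all <;> omega
  · exact absurd ((M.rep_spec v v (Ne.symm hv)).unique ⟨h, hk⟩ ⟨hnil, by simp⟩) hl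

theorem exists_isWalkFrom_iterate {s ℓ : ℕ} {v : M.V} {l : List M.V}
    (h : IsWalkFrom M.Adj (M.rep^[s] v) v l) (hl : l.length = ℓ) (t : ℕ) :
    ∃ l', IsWalkFrom M.Adj (M.rep^[s * t] v) v l' ∧ l'.length = ℓ * t := by
  induction t with
  | zero => exact ⟨[], isWalkFrom_nil.2 rfl, rfl⟩
  | succ t ih =>
    obtain ⟨l', h', hl'⟩ := ih
    have hadj (n : ℕ) : ∀ u v, M.Adj u v → M.Adj (M.rep^[n] u) (M.rep^[n] v) := by
      induction n with
      | zero => exact fun _ _ => id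
      | succ n ih => exact fun u v huv => ih _ _ ((M.rep_adj u v).1 huv)
    refine ⟨l.map (M.rep^[s * t]) ++ l', ?_, by simp [hl, hl', mul_add, add_comm]⟩
    have hmap := h.map (hadj (s * t))
    rw [← Function.iterate_add_apply] at hmap
    exact IsWalkFrom.append hmap (v := M.rep^[s * t] v) ‹_›

/-- If `rep` has small orders, then no walk of length `ℓ` joins two vertices of the same
`rep`-orbit, so `P ^ s * A ^ ℓ` has zero diagonal. -/
theorem trace_repMat_pow_mul_adjMatC_pow (hord : ∀ v : M.V, ordRep M v ≤ d - 1)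
    {ℓ : ℕ} (hℓ : 1 ≤ ℓ) (hlt : ℓ < k) (hbound : ℓ * (d - 1) ≤ k) (s : ℕ) :
    (repMat M ^ s * adjMatC M ^ ℓ).trace = 0 := by
  refine Finset.sum_eq_zero fun v _ => ?_
  simp only [Matrix.diag_apply, Matrix.mul_apply, repMat_pow_apply, adjMatC_pow_apply,
    ite_mul, one_mul, zero_mul, Finset.sum_ite_eq', Finset.mem_univ, if_true]
  rw [Nat.cast_eq_zero, Finset.card_eq_zero, Finset.eq_empty_iff_forall_notMem]
  intro l hl
  obtain ⟨hw, hlen⟩ := mem_walkFinset.1 hl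
  obtain ⟨hpos, hfix⟩ := ordRep_mem M v
  obtain ⟨l', hw', hlen'⟩ := exists_isWalkFrom_iterate M hw hlen (ordRep M v)
  have hfix' : M.rep^[s * ordRep M v] v = v :=
    Function.IsPeriodicPt.const_mul hfix s
  rw [hfix'] at hw'
  have hne : l' ≠ [] := by
    rintro rfl
    have := Nat.mul_pos hℓ hpos
    simp at hlen'
    omega
  have hself := (hw'.closed M hne
    (hlen' ▸ (Nat.mul_le_mul_left ℓ (hord v)).trans hbound)).1
  rw [Function.iterate_fixed hself] at hw
  have hcl := hw.closed M (by rintro rfl; simp at hlen; omega) (by omega)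
  omega

theorem lt_of_ordRep_le (hm1 : {v | M.rep v = v}.ncard = k)
    (hord : ∀ v : M.V, ordRep M v ≤ d - 1) {ℓ : ℕ} (hbound : ℓ * (d - 1) < k + 1) : ℓ < k := by
  have hd := M.hd
  have hk := M.hk
  obtain hd2 | hd3 : d = 2 ∨ 3 ≤ d := by omega
  · subst hd2
    exfalso
    have hall : {v | M.rep v = v} = Set.univ := by
      refine Set.eq_univ_of_forall fun v => ?_
      have h := ordRep_mem M v
      have h1 : ordRep M v = 1 := by have := hord v; omega
      simpa [h1] using h.2
    rw [hall, Set.ncard_univ, Nat.card_eq_fintype_card, M.card_eq] at hm1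
    have : ∑ i ∈ Finset.range k, 2 ≤ ∑ i ∈ Finset.range k, 2 ^ (i + 1) :=
      Finset.sum_le_sum fun i _ => by rw [pow_succ]; have := Nat.one_le_two_pow (n := i); omega
    simp at this
    omega
  · have : ℓ * 2 ≤ ℓ * (d - 1) := Nat.mul_le_mul_left _ (by omega)
    omega

theorem onesMat_mul_repMat_pow (s : ℕ) : onesMat M * repMat M ^ s = onesMat M := by
  induction s with
  | zero => simp
  | succ s ih => rw [pow_succ', ← mul_assoc, onesMat_mul_repMat, ih]

/-- `J + P` acts as `P` on the image of `|V| + 1 - (J + P)`, which `J` annihilates. -/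
theorem onesMat_add_repMat_pow_mul (s : ℕ) :
    (onesMat M + repMat M) ^ s *
        ((Fintype.card M.V : ℂ) • 1 + 1 - (onesMat M + repMat M)) =
      (Fintype.card M.V : ℂ) • repMat M ^ s + repMat M ^ s - onesMat M - repMat M ^ (s + 1) := by
  induction s with
  | zero => simp [sub_sub]
  | succ s ih =>
    rw [pow_succ' (onesMat M + repMat M), mul_assoc, ih]
    simp only [add_mul, mul_add, mul_sub, mul_smul_comm, onesMat_mul_repMat_pow,
      onesMat_mul_onesMat, repMat_mul_onesMat, ← pow_succ', smul_add]
    abel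

end AlmostMoore

theorem Multiset.sum_map_filter_eq_sum_map_ite {α β : Type*} [AddCommMonoid β] (s : Multiset α)
    (p : α → Prop) [DecidablePred p] (f : α → β) :
    ((s.filter p).map f).sum = (s.map fun a => if p a then f a else 0).sum := by
  induction s using Multiset.induction_on with
  | empty => simp
  | cons a s ih => by_cases h : p a <;> simp [h, ih]

/-- Let `G` be an almost Moore digraph with self-repeats and
permutation cycle structure `(k, …, m_{d−1}, 0, …, 0)`, with adjacency matrix `A`.
Let `λ₁, …, λ_{m(1)−1}` be the eigenvalues of `A` (with multiplicity, i.e. the roots of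
the characteristic polynomial of `A` over `ℂ`) that are roots of `x^k + ⋯ + x² + x`.
Then for every `ℓ` with `1 ≤ ℓ < (k+1)/(d−1)` (i.e. `ℓ(d−1) < k+1`) one has
`0 = d^ℓ + Σ_h λ_h^ℓ`. -/
theorem stmt14 {d k : ℕ} (M : AlmostMooreDigraph d k) (hsr : ∃ v, M.rep v = v)
    (hm1 : {v | M.rep v = v}.ncard = k)
    (hord : ∀ v : M.V, ordRep M v ≤ d - 1)
    (ℓ : ℕ) (hℓ : 1 ≤ ℓ) (hbound : ℓ * (d - 1) < k + 1) :
    (d : ℂ) ^ ℓ +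
      ((((adjMatC M).charpoly.roots.filter
          (fun z => Polynomial.eval z (∑ i ∈ Finset.Icc 1 k, Polynomial.X ^ i : Polynomial ℂ) = 0)).map
        (fun z => z ^ ℓ)).sum) = 0 := by
  set A := adjMatC M with hA
  set q : Polynomial ℂ := ∑ i ∈ Finset.Icc 1 k, Polynomial.X ^ i with hq
  obtain ⟨L, hL, hLrep⟩ := exists_rep_iterate_eq_id M
  obtain ⟨v₀, -⟩ := hsr
  have : Nonempty M.V := ⟨v₀⟩
  set N : ℂ := ((Fintype.card M.V : ℕ) : ℂ) with hN
  have hN0 : N ≠ 0 := Nat.cast_ne_zero.2 Fintype.card_ne_zero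
  have hL0 : (L : ℂ) ≠ 0 := Nat.cast_ne_zero.2 hL.ne'
  have hlt := lt_of_ordRep_le M hm1 hord hbound
  have htr := trace_repMat_pow_mul_adjMatC_pow M hord hℓ hlt (Nat.lt_succ_iff.1 hbound)
  rw [← hA] at htr
  have hPL : repMat M ^ L = 1 := by
    ext u v
    rw [repMat_pow_apply, hLrep]
    rcases eq_or_ne u v with rfl | h <;> simp [*, Ne.symm]
  have hqB : Polynomial.aeval A (q + 1) = onesMat M + repMat M := by
    have hI : Finset.Icc 1 k = Finset.Ico 1 (k + 1) := by ext; simp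
    rw [← sum_adjMatC_pow, Finset.range_eq_Ico, Finset.sum_eq_sum_Ico_succ_bot (Nat.succ_pos k),
      hq, hI]
    simp [add_comm, ← hA]
  have hqD : Polynomial.aeval A (Polynomial.C N - q) =
      N • 1 + 1 - (onesMat M + repMat M) := by
    rw [← hqB]
    simp [Algebra.algebraMap_eq_smul_one]
  set g : Polynomial ℂ := (∑ s ∈ Finset.range L, (q + 1) ^ s) * (Polynomial.C N - q) with hg
  have hgA : Polynomial.aeval A g = ∑ s ∈ Finset.range L,
      (N • repMat M ^ s + repMat M ^ s - onesMat M - repMat M ^ (s + 1)) := by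
    rw [hg, map_mul, hqD, map_sum, Finset.sum_mul]
    refine Finset.sum_congr rfl fun s _ => ?_
    rw [map_pow, hqB, onesMat_add_repMat_pow_mul]
  -- Every eigenvalue `z` satisfies `((q z + 1) ^ L - 1) * (N - q z) = 0`.
  have hvanish : Polynomial.aeval A (q * g) = 0 := by
    have e : q * g = (q + 1) ^ L * (Polynomial.C N - q) - (q + 1) ^ 0 * (Polynomial.C N - q) := by
      have := geom_sum_mul (q + 1) L
      rw [add_sub_cancel_right] at this
      rw [hg, ← mul_assoc, mul_comm q, this]
      ring
    rw [e, map_sub, map_mul, map_mul, map_pow, map_pow, hqB, hqD, onesMat_add_repMat_pow_mul,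
      onesMat_add_repMat_pow_mul, pow_succ, hPL]
    simp
  have hroot (z : ℂ) (hz : z ∈ A.charpoly.roots) : q.eval z * g.eval z = 0 := by
    have h := Matrix.roots_charpoly_aeval A (q * g)
    rw [hvanish, Matrix.charpoly_zero, Polynomial.roots_X_pow] at h
    have hmem := Multiset.mem_map_of_mem (q * g).eval hz
    rw [← h] at hmem
    simpa using Multiset.mem_of_mem_nsmul hmem
  have hsum := Matrix.trace_aeval_eq_sum_roots_charpoly A (g * Polynomial.X ^ ℓ)
  have hmap : A.charpoly.roots.map (g * Polynomial.X ^ ℓ).eval =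
      A.charpoly.roots.map fun z => L * N * if q.eval z = 0 then z ^ ℓ else 0 := by
    refine Multiset.map_congr rfl fun z hz => ?_
    split_ifs with h
    · simp [hg, h, Polynomial.eval_finsetSum]
    · simp [(mul_eq_zero.1 (hroot z hz)).resolve_left h]
  have htrace : (Polynomial.aeval A (g * Polynomial.X ^ ℓ)).trace = -(L * N * (d : ℂ) ^ ℓ) := by
    have hJ : (onesMat M * A ^ ℓ).trace = (d : ℂ) ^ ℓ * N := by
      rw [Matrix.trace_mul_comm, adjMatC_pow_mul_onesMat, Matrix.trace_smul]
      simp [onesMat, Matrix.trace, hN]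
    rw [map_mul, hgA, map_pow, Polynomial.aeval_X, Finset.sum_mul, Matrix.trace_sum]
    simp only [sub_mul, add_mul, smul_mul_assoc, Matrix.trace_sub, Matrix.trace_add,
      Matrix.trace_smul, htr, hJ]
    simp
    ring
  rw [htrace, hmap, Multiset.sum_map_mul_left, ← Multiset.sum_map_filter_eq_sum_map_ite] at hsum
  refine mul_left_cancel₀ (mul_ne_zero hL0 hN0) ?_
  rw [mul_add, ← hsum]
  ring
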